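/- arXiv:math/9508212 — 2 statements merged into one kernel-verified Lean document; each statement's English description precedes it below -/
import Mathlib

section
/- For the quadratic polynomial Q(z) = z² − 2, the set of points z ∈ ℂ whose forward orbit {Q^{∘n}(z) : n ∈ ℕ} is bounded equals the real segment [−2, 2] regarded as a subset of ℂ, i.e., it equals {z ∈ ℂ : Im z = 0 and −2 ≤ Re z ≤ 2}. -/
/-- The sum of the distances from `z` to the foci `±2`. -/
noncomputable def focalSum (z : ℂ) : ℝ := ‖z - 2‖ + ‖z + 2‖

theorem norm_sub_two_sq (z : ℂ) : ‖z - 2‖ ^ 2 = (z.re - 2) ^ 2 + z.im ^ 2 := by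
  rw [Complex.sq_norm, Complex.normSq_apply]
  simp
  ring

theorem norm_add_two_sq (z : ℂ) : ‖z + 2‖ ^ 2 = (z.re + 2) ^ 2 + z.im ^ 2 := by
  rw [Complex.sq_norm, Complex.normSq_apply]
  simp
  ring

theorem four_le_focalSum (z : ℂ) : 4 ≤ focalSum z := by
  have h := norm_sub_le (z + 2) (z - 2)
  have h4 : ‖(z + 2) - (z - 2)‖ = 4 := by
    rw [show (z + 2) - (z - 2) = (4 : ℂ) by ring]
    norm_num
  unfold focalSum
  linarith

theorem focalSum_le (z : ℂ) : focalSum z ≤ 2 * ‖z‖ + 4 := by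
  have h₁ := norm_sub_le z 2
  have h₂ := norm_add_le z 2
  rw [Complex.norm_ofNat] at h₁ h₂
  unfold focalSum
  linarith

theorem two_mul_norm_le_focalSum (z : ℂ) : 2 * ‖z‖ ≤ focalSum z := by
  have h := norm_add_le (z - 2) (z + 2)
  rw [show (z - 2) + (z + 2) = 2 * z by ring, norm_mul, Complex.norm_ofNat] at h
  exact h

theorem focalSum_eq_four_iff (z : ℂ) :
    focalSum z = 4 ↔ z.im = 0 ∧ -2 ≤ z.re ∧ z.re ≤ 2 := by
  have hp := norm_add_two_sq z
  have hq := norm_sub_two_sq z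
  have hp0 := norm_nonneg (z + 2)
  have hq0 := norm_nonneg (z - 2)
  unfold focalSum
  constructor
  · intro h
    have h₁ : ‖z - 2‖ = 4 - ‖z + 2‖ := by linarith
    have h₂ : ‖z + 2‖ = 2 + z.re := by rw [h₁] at hq; linarith
    refine ⟨?_, by linarith, by linarith⟩
    rw [h₂] at hp
    exact pow_eq_zero_iff two_ne_zero |>.mp (by linarith)
  · rintro ⟨h, h₁, h₂⟩
    have hp' : ‖z + 2‖ = 2 + z.re :=
      (pow_left_inj₀ hp0 (by linarith) two_ne_zero).mp (by rw [hp, h]; ring)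
    have hq' : ‖z - 2‖ = 2 - z.re :=
      (pow_left_inj₀ hq0 (by linarith) two_ne_zero).mp (by rw [hq, h]; ring)
    rw [hp', hq']
    ring

/-- The map `z ↦ z² - 2` maps each ellipse with foci `±2` into another one. -/
theorem focalSum_sq_sub_two (z : ℂ) : focalSum (z ^ 2 - 2) = focalSum z ^ 2 / 2 - 4 := by
  have hp := norm_add_two_sq z
  have hq := norm_sub_two_sq z
  have hz : ‖z‖ ^ 2 = z.re ^ 2 + z.im ^ 2 := by
    rw [Complex.sq_norm, Complex.normSq_apply]
    ring
  unfold focalSum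
  rw [show z ^ 2 - 2 - 2 = (z - 2) * (z + 2) by ring, show z ^ 2 - 2 + 2 = z ^ 2 by ring,
    norm_mul, norm_pow]
  linarith

theorem focalSum_iterate_sub_four_ge (z : ℂ) (n : ℕ) :
    4 ^ n * (focalSum z - 4) ≤ focalSum ((fun w : ℂ => w ^ 2 - 2)^[n] z) - 4 := by
  induction n with
  | zero => simp
  | succ n ih =>
    rw [Function.iterate_succ_apply', focalSum_sq_sub_two, pow_succ]
    nlinarith [sq_nonneg (focalSum ((fun w : ℂ => w ^ 2 - 2)^[n] z) - 4)]

theorem focalSum_iterate_eq_four {z : ℂ} (hz : focalSum z = 4) (n : ℕ) :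
    focalSum ((fun w : ℂ => w ^ 2 - 2)^[n] z) = 4 := by
  induction n with
  | zero => exact hz
  | succ n ih =>
    rw [Function.iterate_succ_apply', focalSum_sq_sub_two, ih]
    norm_num

/-- The filled Julia set of `Q(z) = z² − 2` is the real segment `[-2, 2] ⊆ ℂ`. -/
theorem filledJulia_of_zsq_sub_two_eq_segment :
    {z : ℂ | Bornology.IsBounded (Set.range fun n : ℕ => (fun w : ℂ => w ^ 2 - 2)^[n] z)}
      = {z : ℂ | z.im = 0 ∧ -2 ≤ z.re ∧ z.re ≤ 2} := by
  ext z
  rw [Set.mem_ofPred_eq, Set.mem_ofPred_eq, ← focalSum_eq_four_iff, isBounded_iff_forall_norm_le]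
  constructor
  · rintro ⟨C, hC⟩
    by_contra h
    have hpos : 0 < focalSum z - 4 :=
      sub_pos.mpr (lt_of_le_of_ne (four_le_focalSum z) (Ne.symm h))
    obtain ⟨n, hn⟩ :=
      pow_unbounded_of_one_lt (2 * C / (focalSum z - 4)) (by norm_num : (1 : ℝ) < 4)
    rw [div_lt_iff₀ hpos] at hn
    have h₁ := hC _ (Set.mem_range_self n)
    have h₂ := focalSum_le ((fun w : ℂ => w ^ 2 - 2)^[n] z)
    have h₃ := focalSum_iterate_sub_four_ge z n
    linarith
  · intro h
    refine ⟨2, ?_⟩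
    rintro _ ⟨n, rfl⟩
    have h₁ := two_mul_norm_le_focalSum ((fun w : ℂ => w ^ 2 - 2)^[n] z)
    rw [focalSum_iterate_eq_four h n] at h₁
    linarith
end

section
/- Let c ∈ ℂ and let B ⊆ ℂ be an open, connected, simply connected set containing the critical value c of P_c(z) = z² + c. Then the preimage U = P_c^{-1}(B) = {z ∈ ℂ : z² + c ∈ B} is an open, connected, simply connected set containing the critical point 0, and the restriction P_c : U → B is a proper map (preimages in U of compact subsets of B are compact). -/
open Set Filter Topology Metric ComplexConjugate

/-- The involutive automorphism of the unit disc that exchanges `a` and `0`. -/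
noncomputable def discInvolution (a z : ℂ) : ℂ := (a - z) / (1 - conj a * z)

lemma one_sub_conj_mul_ne_zero {a z : ℂ} (ha : ‖a‖ < 1) (hz : ‖z‖ < 1) :
    1 - conj a * z ≠ 0 := by
  intro h
  have h1 : ‖conj a * z‖ = 1 := by rw [← sub_eq_zero.mp h, norm_one]
  rw [norm_mul, RCLike.norm_conj] at h1
  nlinarith [norm_nonneg a, norm_nonneg z]

lemma norm_discInvolution_lt_one {a z : ℂ} (ha : ‖a‖ < 1) (hz : ‖z‖ < 1) :
    ‖discInvolution a z‖ < 1 := by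
  rw [discInvolution, norm_div, div_lt_one (norm_pos_iff.mpr (one_sub_conj_mul_ne_zero ha hz))]
  refine lt_of_pow_lt_pow_left₀ 2 (norm_nonneg _) ?_
  have ha' : ‖a‖ ^ 2 < 1 := by nlinarith [norm_nonneg a]
  have hz' : ‖z‖ ^ 2 < 1 := by nlinarith [norm_nonneg z]
  simp only [Complex.sq_norm, Complex.normSq_apply] at *
  simp only [Complex.sub_re, Complex.sub_im, Complex.mul_re, Complex.mul_im, Complex.conj_re,
    Complex.conj_im, Complex.one_re, Complex.one_im]
  nlinarith [mul_pos (sub_pos.mpr ha') (sub_pos.mpr hz')]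

lemma discInvolution_involutive {a z : ℂ} (ha : ‖a‖ < 1) (hz : ‖z‖ < 1) :
    discInvolution a (discInvolution a z) = z := by
  have h1 := one_sub_conj_mul_ne_zero ha hz
  have h2 := one_sub_conj_mul_ne_zero ha ha
  have h3 := one_sub_conj_mul_ne_zero ha (norm_discInvolution_lt_one ha hz)
  rw [discInvolution, div_eq_iff h3]
  have h4 : 1 - z * conj a ≠ 0 := by rwa [mul_comm]
  unfold discInvolution
  field_simp
  ring

lemma discInvolution_self (a : ℂ) : discInvolution a a = 0 := by simp [discInvolution]

lemma discInvolution_zero (a : ℂ) : discInvolution a 0 = a := by simp [discInvolution]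

lemma differentiableAt_discInvolution {a z : ℂ} (ha : ‖a‖ < 1) (hz : ‖z‖ < 1) :
    DifferentiableAt ℂ (discInvolution a) z := by
  unfold discInvolution
  have := one_sub_conj_mul_ne_zero ha hz
  fun_prop (disch := assumption)

/-- Up to a disc automorphism, `z ↦ z²` decreases the modulus strictly. -/
lemma norm_discInvolution_sq_lt {s q : ℂ} (hs : ‖s‖ < 1) (hq : ‖q‖ < 1) (hsq : s ≠ q) :
    ‖discInvolution (s ^ 2) (q ^ 2)‖ < ‖discInvolution s q‖ := by
  have hns : ‖-s‖ < 1 := by rwa [norm_neg]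
  have h1 := one_sub_conj_mul_ne_zero hs hq
  have h2 := one_sub_conj_mul_ne_zero hns hq
  have h3 := one_sub_conj_mul_ne_zero (a := s ^ 2) (z := q ^ 2)
    (by rw [norm_pow]; exact pow_lt_one₀ (norm_nonneg _) hs two_ne_zero)
    (by rw [norm_pow]; exact pow_lt_one₀ (norm_nonneg _) hq two_ne_zero)
  have key : discInvolution (s ^ 2) (q ^ 2) = -(discInvolution s q * discInvolution (-s) q) := by
    unfold discInvolution
    rw [div_mul_div_comm, ← neg_div, div_eq_div_iff h3 (mul_ne_zero h1 h2)]
    simp only [map_neg, map_pow]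
    ring
  have hpos : 0 < ‖discInvolution s q‖ :=
    norm_pos_iff.mpr (div_ne_zero (sub_ne_zero.mpr hsq) h1)
  rw [key, norm_neg, norm_mul]
  exact mul_lt_of_lt_one_right hpos (norm_discInvolution_lt_one hns hq)

/-- A holomorphic function without zeros on a simply connected open set has a holomorphic
square root. -/
lemma exists_differentiableOn_sq_eq {B : Set ℂ} (hB : IsOpen B) (hsc : IsSimplyConnected B)
    {p : ℂ → ℂ} (hp : DifferentiableOn ℂ p B) (hp0 : ∀ z ∈ B, p z ≠ 0) :
    ∃ q : ℂ → ℂ, DifferentiableOn ℂ q B ∧ ∀ z, q z ^ 2 = p z := by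
  obtain ⟨q, hqc, hq⟩ := Complex.exists_continuousOn_pow_eq hsc hB hp.continuousOn
    (by rintro ⟨z, hz, h⟩; exact hp0 z hz h) two_ne_zero
  refine ⟨q, fun z hz ↦ ?_, hq⟩
  have hqz : q z ≠ 0 := fun h ↦ hp0 z hz (by rw [← hq, h]; simp)
  have hcont : ContinuousAt q z := hqc.continuousAt (hB.mem_nhds hz)
  have hd := (hp.differentiableAt (hB.mem_nhds hz)).hasDerivAt
  have hsum : Tendsto (fun w ↦ q w + q z) (𝓝 z) (𝓝 (q z + q z)) := hcont.add_const _
  have hne : q z + q z ≠ 0 := by rw [← two_mul]; exact mul_ne_zero two_ne_zero hqz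
  refine HasDerivAt.differentiableAt (f' := deriv p z / (q z + q z)) ?_ |>.differentiableWithinAt
  rw [hasDerivAt_iff_tendsto_slope] at hd ⊢
  refine (hd.div (hsum.mono_left nhdsWithin_le_nhds) hne).congr' ?_
  filter_upwards [nhdsWithin_le_nhds (hsum.eventually_ne hne)] with w hw
  rw [Pi.div_apply, slope_def_field, slope_def_field, ← hq w, ← hq z, div_eq_iff hw]
  ring

/-- **Hurwitz's theorem**: a locally uniform limit of holomorphic functions without zeros either
has no zeros or vanishes identically. -/
lemma TendstoLocallyUniformlyOn.ne_zero_or_eqOn_zero {ι : Type*} {l : Filter ι} [l.NeBot]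
    {B : Set ℂ} (hB : IsOpen B) (hBc : IsPreconnected B) {F : ι → ℂ → ℂ} {f : ℂ → ℂ}
    (hlim : TendstoLocallyUniformlyOn F f l B) (hF : ∀ n, DifferentiableOn ℂ (F n) B)
    (hne : ∀ n, ∀ z ∈ B, F n z ≠ 0) : (∀ z ∈ B, f z ≠ 0) ∨ EqOn f 0 B := by
  by_contra! h
  obtain ⟨⟨z₀, hz₀, hfz₀⟩, hnot⟩ := h
  have hf : DifferentiableOn ℂ f B := hlim.differentiableOn (.of_forall hF) hB
  have hfreq : ∀ᶠ z in 𝓝[≠] z₀, f z ≠ 0 := by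
    by_contra h
    refine hnot ((hf.analyticOnNhd hB).eqOn_zero_of_preconnected_of_frequently_eq_zero hBc hz₀ ?_)
    simpa only [Filter.Frequently] using h
  rw [eventually_nhdsWithin_iff] at hfreq
  obtain ⟨r, hr, hball⟩ := nhds_basis_closedBall.mem_iff.mp (hfreq.and (hB.mem_nhds hz₀))
  have hsub : closedBall z₀ r ⊆ B := fun z hz ↦ (hball hz).2
  have hsph : ∀ z ∈ sphere z₀ r, f z ≠ 0 := fun z hz ↦
    (hball (sphere_subset_closedBall hz)).1 (ne_of_mem_sphere hz hr.ne')
  obtain ⟨w, hw, hmin⟩ := (isCompact_sphere z₀ r).exists_isMinOn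
    (NormedSpace.sphere_nonempty.mpr hr.le)
    (hf.continuousOn.mono (sphere_subset_closedBall.trans hsub)).norm
  have hδ : 0 < ‖f w‖ := norm_pos_iff.mpr (hsph w hw)
  have hunif := (tendstoLocallyUniformlyOn_iff_forall_isCompact hB).mp hlim _ hsub
    (isCompact_closedBall z₀ r)
  obtain ⟨n, hn⟩ := (Metric.tendstoUniformlyOn_iff.mp hunif (‖f w‖ / 2) (half_pos hδ)).exists
  have hlow : ∀ z ∈ sphere z₀ r, ‖f w‖ / 2 ≤ ‖F n z‖ := fun z hz ↦ by
    have h1 : ‖f w‖ ≤ ‖f z‖ := hmin hz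
    have h2 := hn z (sphere_subset_closedBall hz)
    rw [dist_eq_norm] at h2
    linarith [norm_sub_norm_le (f z) (F n z)]
  have hcentre : ‖F n z₀‖ < ‖f w‖ / 2 := by
    simpa [hfz₀] using hn z₀ (mem_closedBall_self hr.le)
  have hinv : DiffContOnCl ℂ (fun z ↦ (F n z)⁻¹) (ball z₀ r) := by
    refine DifferentiableOn.diffContOnCl ?_
    rw [closure_ball _ hr.ne']
    exact ((hF n).mono hsub).inv fun z hz ↦ hne n z (hsub hz)
  have hmax := Complex.norm_le_of_forall_mem_frontier_norm_le isBounded_ball hinv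
    (C := (‖f w‖ / 2)⁻¹) (fun z hz ↦ by
      rw [frontier_ball _ hr.ne'] at hz
      rw [norm_inv]
      exact inv_anti₀ (half_pos hδ) (hlow z hz)) (subset_closure (mem_ball_self hr))
  rw [norm_inv] at hmax
  exact hcentre.not_ge
    ((inv_le_inv₀ (norm_pos_iff.mpr (hne n z₀ hz₀)) (half_pos hδ)).mp hmax)

/-- A pointwise bounded limit of holomorphic maps into the unit disc is a locally uniform limit. -/
lemma tendstoLocallyUniformlyOn_of_norm_lt_one {ι : Type*} {l : Filter ι} [l.NeBot] {B : Set ℂ}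
    (hB : IsOpen B) {F : ι → ℂ → ℂ} {f : ℂ → ℂ} (hF : ∀ n, DifferentiableOn ℂ (F n) B)
    (hF1 : ∀ n, ∀ z ∈ B, ‖F n z‖ < 1) (hlim : ∀ z ∈ B, Tendsto (F · z) l (𝓝 (f z))) :
    TendstoLocallyUniformlyOn F f l B := by
  rw [Metric.tendstoLocallyUniformlyOn_iff]
  intro ε hε z hz
  obtain ⟨r, hr, hball⟩ := Metric.isOpen_iff.mp hB z hz
  have hlip : ∀ n, ∀ w ∈ ball z r, dist (F n w) (F n z) ≤ 2 / r * dist w z := fun n w hw ↦ by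
    refine Complex.dist_le_div_mul_dist_of_mapsTo_ball ((hF n).mono hball) (fun x hx ↦ ?_) hw
    rw [mem_closedBall, dist_eq_norm]
    linarith [norm_sub_le (F n x) (F n z), hF1 n x (hball hx), hF1 n z hz]
  have hlip' : ∀ w ∈ ball z r, dist (f w) (f z) ≤ 2 / r * dist w z := fun w hw ↦
    le_of_tendsto ((hlim w (hball hw)).dist (hlim z hz)) (.of_forall fun n ↦ hlip n w hw)
  have hρ : 0 < ε / 3 * (r / 2) := by positivity
  refine ⟨ball z r ∩ ball z (ε / 3 * (r / 2)), mem_nhdsWithin_of_mem_nhds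
    (inter_mem (ball_mem_nhds z hr) (ball_mem_nhds z hρ)), ?_⟩
  filter_upwards [Metric.tendsto_nhds.mp (hlim z hz) (ε / 3) (by positivity)] with n hn w hw
  have hsmall : 2 / r * dist w z < ε / 3 := by
    have := mul_lt_mul_of_pos_left (mem_ball.mp hw.2) (show 0 < 2 / r by positivity)
    rwa [show 2 / r * (ε / 3 * (r / 2)) = ε / 3 by field_simp] at this
  have h1 := hlip n w hw.1
  have h2 := hlip' w hw.1
  have h3 := dist_triangle4_right (f w) (F n w) (f z) (F n z)
  rw [dist_comm] at hn
  linarith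

/-- `f` is a conformal embedding of `B` into the unit disc that sends `c` to `0`. -/
structure IsDiscEmbedding (B : Set ℂ) (c : ℂ) (f : ℂ → ℂ) : Prop where
  differentiableOn : DifferentiableOn ℂ f B
  norm_lt_one : ∀ z ∈ B, ‖f z‖ < 1
  injOn : InjOn f B
  deriv_ne_zero : ∀ z ∈ B, deriv f z ≠ 0
  map_base : f c = 0

lemma deriv_ne_zero_of_eqOn_comp {B : Set ℂ} (hB : IsOpen B) {f H k : ℂ → ℂ} {z : ℂ} (hz : z ∈ B)
    (hf : DifferentiableAt ℂ f z) (hH : DifferentiableAt ℂ H (f z)) (hk : EqOn k (H ∘ f) B)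
    (hk' : deriv k z ≠ 0) : deriv f z ≠ 0 := by
  intro h
  rw [(hk.eventuallyEq_of_mem (hB.mem_nhds hz)).deriv_eq, deriv_comp z hH hf, h, mul_zero] at hk'
  exact hk' rfl

lemma exists_isDiscEmbedding {B : Set ℂ} (hB : IsOpen B) (hsc : IsSimplyConnected B)
    (hne : B ≠ univ) {c : ℂ} (hc : c ∈ B) : ∃ f, IsDiscEmbedding B c f := by
  obtain ⟨a, ha⟩ := (ne_univ_iff_exists_notMem B).mp hne
  have hp0 : ∀ z ∈ B, z - a ≠ 0 := fun z hz h ↦ ha (sub_eq_zero.mp h ▸ hz)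
  obtain ⟨q, hqd, hq⟩ := exists_differentiableOn_sq_eq hB hsc
    (p := fun z ↦ z - a) (by fun_prop) hp0
  have hqinj : Function.Injective q := fun z w h ↦ by
    have := (hq z).symm.trans ((congrArg (· ^ 2) h).trans (hq w))
    simpa using this
  have hq0 : ∀ z ∈ B, q z ≠ 0 := fun z hz h ↦ hp0 z hz (by rw [← hq z, h]; simp)
  have hqan : AnalyticAt ℂ q c := hqd.analyticAt (hB.mem_nhds hc)
  have himg : q '' B ∈ 𝓝 (q c) := by
    rcases hqan.eventually_constant_or_nhds_le_map_nhds with h | h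
    · have : ∀ᶠ z in 𝓝[≠] c, False := by
        filter_upwards [nhdsWithin_le_nhds h, self_mem_nhdsWithin] with z hz hzc
        exact hzc (hqinj hz)
      simp only [eventually_false_iff_eq_bot] at this
      exact (NeBot.ne inferInstance this).elim
    · exact h (image_mem_map (hB.mem_nhds hc))
  obtain ⟨ε, hε, hball⟩ := Metric.mem_nhds_iff.mp himg
  have hfar : ∀ z ∈ B, ε ≤ ‖q z + q c‖ := fun z hz ↦ by
    by_contra! h
    obtain ⟨w, hw, hwz⟩ := hball (show -q z ∈ ball (q c) ε by
      rwa [mem_ball, dist_eq_norm, ← neg_add', norm_neg])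
    have hwz' : w = z := by
      have := (hq w).symm.trans ((congrArg (· ^ 2) hwz).trans ((neg_sq _).trans (hq z)))
      simpa using this
    subst hwz'
    exact hq0 w hw (self_eq_neg.mp hwz)
  have hfar0 : ∀ z ∈ B, q z + q c ≠ 0 := fun z hz ↦ norm_pos_iff.mp (hε.trans_le (hfar z hz))
  set g : ℂ → ℂ := fun z ↦ (ε / 2 : ℝ) / (q z + q c) with hg
  have hε0 : ((ε / 2 : ℝ) : ℂ) ≠ 0 := by exact_mod_cast (half_pos hε).ne'
  have hg1 : ∀ z ∈ B, ‖g z‖ < 1 := fun z hz ↦ by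
    rw [hg, norm_div, div_lt_one (norm_pos_iff.mpr (hfar0 z hz)), Complex.norm_real,
      Real.norm_of_nonneg (half_pos hε).le]
    linarith [hfar z hz]
  have hgd : DifferentiableOn ℂ g B := (differentiableOn_const _).div (hqd.add_const _) hfar0
  have hgc := hg1 c hc
  have hg0 : ∀ z ∈ B, g z ≠ 0 := fun z hz ↦ div_ne_zero hε0 (hfar0 z hz)
  -- The inverse of the embedding, up to the disc automorphism.
  set K : ℂ → ℂ := fun t ↦ ((ε / 2 : ℝ) / t - q c) ^ 2 + a with hK
  have hKg : ∀ z ∈ B, K (g z) = z := fun z hz ↦ by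
    have h1 := hfar0 z hz
    have : ((ε / 2 : ℝ) : ℂ) / g z = q z + q c := by
      rw [hg, div_div_cancel₀ hε0]
    rw [hK]
    simp only [this, add_sub_cancel_right, hq, sub_add_cancel]
  have hinv : ∀ z ∈ B, K (discInvolution (g c) (discInvolution (g c) (g z))) = z := fun z hz ↦ by
    rw [discInvolution_involutive hgc (hg1 z hz), hKg z hz]
  have hfd : ∀ z ∈ B, DifferentiableAt ℂ (fun z ↦ discInvolution (g c) (g z)) z := fun z hz ↦
    (differentiableAt_discInvolution hgc (hg1 z hz)).comp z (hgd.differentiableAt (hB.mem_nhds hz))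
  refine ⟨fun z ↦ discInvolution (g c) (g z), fun z hz ↦ (hfd z hz).differentiableWithinAt,
    fun z hz ↦ norm_discInvolution_lt_one hgc (hg1 z hz), fun z hz w hw h ↦ ?_, fun z hz ↦ ?_,
    discInvolution_self _⟩
  · rw [← hinv z hz, ← hinv w hw]
    exact congrArg (fun t ↦ K (discInvolution (g c) t)) h
  · refine deriv_ne_zero_of_eqOn_comp hB hz (hfd z hz)
      (H := fun t ↦ K (discInvolution (g c) t)) (k := id) ?_ (fun w hw ↦ (hinv w hw).symm) (by simp)
    refine DifferentiableAt.comp (g := K) (f := discInvolution (g c)) _ ?_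
      (differentiableAt_discInvolution hgc (norm_discInvolution_lt_one hgc (hg1 z hz)))
    rw [discInvolution_involutive hgc (hg1 z hz)]
    have := hg0 z hz
    fun_prop (disch := assumption)

lemma IsDiscEmbedding.exists_norm_lt {B : Set ℂ} (hB : IsOpen B) (hsc : IsSimplyConnected B)
    {b c : ℂ} (hb : b ∈ B) (hc : c ∈ B) (hbc : b ≠ c) {f : ℂ → ℂ} (hf : IsDiscEmbedding B c f)
    {w : ℂ} (hw : ‖w‖ < 1) (hwf : ∀ z ∈ B, f z ≠ w) :
    ∃ g, IsDiscEmbedding B c g ∧ ‖f b‖ < ‖g b‖ := by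
  have hfw : ∀ z ∈ B, ‖discInvolution w (f z)‖ < 1 := fun z hz ↦
    norm_discInvolution_lt_one hw (hf.norm_lt_one z hz)
  obtain ⟨q, hqd, hq⟩ := exists_differentiableOn_sq_eq hB hsc
    (p := fun z ↦ discInvolution w (f z))
    (fun z hz ↦ ((differentiableAt_discInvolution hw (hf.norm_lt_one z hz)).comp z
      (hf.differentiableOn.differentiableAt (hB.mem_nhds hz))).differentiableWithinAt)
    (fun z hz ↦ div_ne_zero (sub_ne_zero.mpr (hwf z hz).symm)
      (one_sub_conj_mul_ne_zero hw (hf.norm_lt_one z hz)))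
  have hq1 : ∀ z ∈ B, ‖q z‖ < 1 := fun z hz ↦ by
    have := hfw z hz
    rw [← hq z, norm_pow] at this
    exact (pow_lt_one_iff_of_nonneg (norm_nonneg _) two_ne_zero).mp this
  have hs := hq1 c hc
  have hsw : q c ^ 2 = w := by rw [hq, hf.map_base, discInvolution_zero]
  have hfq : ∀ z ∈ B, discInvolution w (q z ^ 2) = f z := fun z hz ↦ by
    rw [hq, discInvolution_involutive hw (hf.norm_lt_one z hz)]
  have hinv : ∀ z ∈ B,
      f z = discInvolution w (discInvolution (q c) (discInvolution (q c) (q z)) ^ 2) :=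
    fun z hz ↦ by rw [discInvolution_involutive hs (hq1 z hz), hfq z hz]
  have hgd : ∀ z ∈ B, DifferentiableAt ℂ (fun z ↦ discInvolution (q c) (q z)) z := fun z hz ↦
    (differentiableAt_discInvolution hs (hq1 z hz)).comp z (hqd.differentiableAt (hB.mem_nhds hz))
  refine ⟨fun z ↦ discInvolution (q c) (q z), ⟨fun z hz ↦ (hgd z hz).differentiableWithinAt,
    fun z hz ↦ norm_discInvolution_lt_one hs (hq1 z hz), fun z hz z' hz' h ↦ ?_, fun z hz ↦ ?_,
    discInvolution_self _⟩, ?_⟩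
  · refine hf.injOn hz hz' ?_
    rw [hinv z hz, hinv z' hz']
    exact congrArg (fun t ↦ discInvolution w (discInvolution (q c) t ^ 2)) h
  · refine deriv_ne_zero_of_eqOn_comp hB hz (hgd z hz)
      (H := fun t ↦ discInvolution w (discInvolution (q c) t ^ 2)) (k := f) ?_ hinv
      (hf.deriv_ne_zero z hz)
    refine DifferentiableAt.comp (g := discInvolution w)
      (f := fun t ↦ discInvolution (q c) t ^ 2) _ ?_ ((differentiableAt_discInvolution hs
        (norm_discInvolution_lt_one hs (hq1 z hz))).pow 2)
    rw [discInvolution_involutive hs (hq1 z hz), hq]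
    exact differentiableAt_discInvolution hw (hfw z hz)
  · rw [← hfq b hb]
    nth_rw 1 [← hsw]
    refine norm_discInvolution_sq_lt hs (hq1 b hb) fun h ↦ hbc (hf.injOn hb hc ?_)
    rw [← hfq b hb, ← hfq c hc, h]

/-- Among the conformal embeddings of `B` into the unit disc that send `c` to `0`, there is one for
which `‖f b‖` is largest. -/
lemma exists_isDiscEmbedding_forall_norm_le {B : Set ℂ} (hB : IsOpen B) (hBc : IsPreconnected B)
    {b c : ℂ} (hb : b ∈ B) (hc : c ∈ B) (hbc : b ≠ c) (hex : ∃ f, IsDiscEmbedding B c f) :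
    ∃ f, IsDiscEmbedding B c f ∧ ∀ g, IsDiscEmbedding B c g → ‖g b‖ ≤ ‖f b‖ := by
  set S : Set ℝ := {x | ∃ f, IsDiscEmbedding B c f ∧ ‖f b‖ = x} with hS
  obtain ⟨f₀, hf₀⟩ := hex
  have hSne : S.Nonempty := ⟨_, f₀, hf₀, rfl⟩
  have hSbdd : BddAbove S := ⟨1, by rintro x ⟨f, hf, rfl⟩; exact (hf.norm_lt_one b hb).le⟩
  have hSpos : 0 < sSup S := by
    refine lt_of_lt_of_le (norm_pos_iff.mpr fun h ↦ hbc (hf₀.injOn hb hc ?_))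
      (le_csSup hSbdd ⟨f₀, hf₀, rfl⟩)
    rw [h, hf₀.map_base]
  obtain ⟨u, -, hu, huS⟩ := exists_seq_tendsto_sSup hSne hSbdd
  choose F hF hFu using huS
  have hlim : ∀ z, ∃ y, z ∈ B →
      Tendsto (F · z) ((hyperfilter ℕ : Ultrafilter ℕ) : Filter ℕ) (𝓝 y) := fun z ↦ by
    by_cases hz : z ∈ B
    · obtain ⟨y, -, hy⟩ := (isCompact_closedBall (0 : ℂ) 1).ultrafilter_le_nhds
        ((hyperfilter ℕ).map (F · z)) (by
          rw [le_principal_iff]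
          exact Filter.mem_map.mpr (univ_mem' fun n ↦ by
            simpa using ((hF n).norm_lt_one z hz).le))
      exact ⟨y, fun _ ↦ hy⟩
    · exact ⟨0, fun h ↦ (hz h).elim⟩
  choose f hf using hlim
  have hunif : TendstoLocallyUniformlyOn F f (hyperfilter ℕ : Ultrafilter ℕ) B :=
    tendstoLocallyUniformlyOn_of_norm_lt_one hB (fun n ↦ (hF n).differentiableOn)
      (fun n ↦ (hF n).norm_lt_one) hf
  have hfd : DifferentiableOn ℂ f B :=
    hunif.differentiableOn (.of_forall fun n ↦ (hF n).differentiableOn) hB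
  have hfc : f c = 0 := tendsto_nhds_unique (hf c hc) (by simp [(hF _).map_base])
  have hfb : ‖f b‖ = sSup S := by
    refine tendsto_nhds_unique (hf b hb).norm ?_
    simp only [hFu]
    exact hu.mono_left Nat.hyperfilter_le_atTop
  have hnc : ∀ y, ¬ EqOn f (fun _ ↦ y) B := fun y h ↦ by
    rw [h hb, ← h hc, hfc, norm_zero] at hfb
    exact hSpos.ne hfb
  have hf1 : ∀ z ∈ B, ‖f z‖ ≤ 1 := fun z hz ↦
    le_of_tendsto (hf z hz).norm (.of_forall fun n ↦ ((hF n).norm_lt_one z hz).le)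
  refine ⟨f, ⟨hfd, fun z hz ↦ ?_, fun z hz w hw hzw ↦ ?_, ?_, hfc⟩, fun g hg ↦ ?_⟩
  · refine (hf1 z hz).lt_of_ne fun h ↦ hnc (f z) ?_
    exact Complex.eqOn_of_isPreconnected_of_isMaxOn_norm hBc hB hfd hz fun w hw ↦ by
      simpa [h] using hf1 w hw
  · by_contra hne
    obtain ⟨r, hr, hball⟩ := Metric.isOpen_iff.mp (hB.inter (isOpen_ne (x := z))) w
      ⟨hw, Ne.symm hne⟩
    have hlim' : TendstoLocallyUniformlyOn (fun n x ↦ F n x - F n z) (fun x ↦ f x - f z)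
        (hyperfilter ℕ : Ultrafilter ℕ) (ball w r) := by
      have hconst : TendstoLocallyUniformlyOn (fun n (_ : ℂ) ↦ F n z) (fun _ ↦ f z)
          (hyperfilter ℕ : Ultrafilter ℕ) (ball w r) :=
        ((hf z hz).tendstoUniformlyOn_const _).tendstoLocallyUniformlyOn
      exact (hunif.mono fun x hx ↦ (hball hx).1).sub hconst
    rcases hlim'.ne_zero_or_eqOn_zero isOpen_ball (convex_ball w r).isPreconnected
      (fun n ↦ ((hF n).differentiableOn.mono fun x hx ↦ (hball hx).1).sub_const _)
      (fun n x hx h ↦ (hball hx).2 ((hF n).injOn (hball hx).1 hz (sub_eq_zero.mp h))) with h | h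
    · exact h w (mem_ball_self hr) (sub_eq_zero.mpr hzw.symm)
    · refine hnc (f z) ((hfd.analyticOnNhd hB).eqOn_of_preconnected_of_eventuallyEq
        analyticOnNhd_const hBc hw ?_)
      filter_upwards [ball_mem_nhds w hr] with x hx
      exact sub_eq_zero.mp (h hx)
  · refine ((hunif.deriv (.of_forall fun n ↦ (hF n).differentiableOn) hB).ne_zero_or_eqOn_zero hB
      hBc (fun n ↦ (hF n).differentiableOn.deriv hB) (fun n ↦ (hF n).deriv_ne_zero)).resolve_right
      fun h ↦ hnc (f c) fun z hz ↦ ?_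
    exact hB.is_const_of_deriv_eq_zero hBc hfd h hz hc
  · exact hfb ▸ le_csSup hSbdd ⟨g, hg, rfl⟩

/-- **Riemann mapping theorem**. -/
lemma exists_isDiscEmbedding_surjOn {B : Set ℂ} (hB : IsOpen B) (hsc : IsSimplyConnected B)
    (hne : B ≠ univ) {c : ℂ} (hc : c ∈ B) :
    ∃ f, IsDiscEmbedding B c f ∧ SurjOn f B (ball 0 1) := by
  obtain ⟨b, hb, hbc⟩ : (B ∩ {c}ᶜ).Nonempty := nonempty_of_mem (f := 𝓝[≠] c)
    (inter_mem (nhdsWithin_le_nhds (hB.mem_nhds hc)) self_mem_nhdsWithin)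
  obtain ⟨f, hf, hmax⟩ := exists_isDiscEmbedding_forall_norm_le hB
    hsc.isPathConnected.isConnected.isPreconnected hb hc hbc
    (exists_isDiscEmbedding hB hsc hne hc)
  refine ⟨f, hf, fun w hw ↦ ?_⟩
  by_contra hwf
  obtain ⟨g, hg, hlt⟩ := hf.exists_norm_lt hB hsc hb hc hbc (mem_ball_zero_iff.mp hw)
    fun z hz h ↦ hwf ⟨z, hz, h⟩
  exact (hmax g hg).not_gt hlt

/-- An injective holomorphic map is an open embedding. -/
lemma isOpenEmbedding_restrict_of_injOn {U : Set ℂ} (hU : IsOpen U) {f : ℂ → ℂ}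
    (hf : DifferentiableOn ℂ f U) (hinj : InjOn f U) : IsOpenEmbedding (fun z : U ↦ f z) := by
  refine .of_continuous_injective_isOpenMap hf.continuousOn.domRestrict hinj.injective
    (IsOpenMap.of_nhds_le fun z ↦ ?_)
  have hmap : map (fun z : U ↦ f z) (𝓝 z) = map f (𝓝 (z : ℂ)) := by
    rw [← hU.isOpenEmbedding_subtypeVal.map_nhds_eq, Filter.map_map]
    rfl
  rw [hmap]
  refine ((hf.analyticAt (hU.mem_nhds z.2)).eventually_constant_or_nhds_le_map_nhds).resolve_left
    fun h ↦ ?_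
  have hfalse : ∀ᶠ w in 𝓝[≠] (z : ℂ), False := by
    filter_upwards [nhdsWithin_le_nhds h, nhdsWithin_le_nhds (hU.mem_nhds z.2),
      self_mem_nhdsWithin] with w hw hwU hne
    exact hne (hinj hwU z.2 hw)
  exact hfalse.exists.elim fun _ h ↦ h

/-- The double cover of a simply connected domain branched at one point is conformally
equivalent to the disc. -/
lemma exists_injOn_image_eq_ball {B : Set ℂ} (hB : IsOpen B) (hsc : IsSimplyConnected B)
    (hne : B ≠ univ) {c : ℂ} (hc : c ∈ B) :
    ∃ ψ : ℂ → ℂ, DifferentiableOn ℂ ψ {z | z ^ 2 + c ∈ B} ∧ InjOn ψ {z | z ^ 2 + c ∈ B} ∧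
      ψ '' {z | z ^ 2 + c ∈ B} = ball 0 1 := by
  obtain ⟨f, hf, hsurj⟩ := exists_isDiscEmbedding_surjOn hB hsc hne hc
  have hmul : ∀ w, (w - c) * dslope f c w = f w := fun w ↦ by
    simpa [hf.map_base] using sub_smul_dslope f c w
  obtain ⟨g, hgd, hg⟩ := exists_differentiableOn_sq_eq hB hsc (p := dslope f c)
    ((Complex.differentiableOn_dslope (hB.mem_nhds hc)).mpr hf.differentiableOn) fun w hw h ↦ by
      by_cases hwc : w = c
      · subst hwc
        rw [dslope_same] at h
        exact hf.deriv_ne_zero w hw h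
      · refine hwc (hf.injOn hw hc ?_)
        rw [hf.map_base, ← hmul, h, mul_zero]
  set ψ : ℂ → ℂ := fun z ↦ z * g (z ^ 2 + c) with hψ
  have hsq : ∀ z, ψ z ^ 2 = f (z ^ 2 + c) := fun z ↦ by
    rw [hψ, mul_pow, hg, ← hmul (z ^ 2 + c), add_sub_cancel_right]
  have hodd : ∀ z, ψ (-z) = -ψ z := fun z ↦ by simp [hψ]
  refine ⟨ψ, ?_, fun z hz w hw hzw ↦ ?_, Subset.antisymm ?_ fun t ht ↦ ?_⟩
  · exact differentiableOn_id.mul (hgd.comp (by fun_prop) fun z hz ↦ hz)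
  · have h1 : z ^ 2 + c = w ^ 2 + c := hf.injOn hz hw (by rw [← hsq, ← hsq, hzw])
    rcases sq_eq_sq_iff_eq_or_eq_neg.mp (add_right_cancel h1) with h | rfl
    · exact h
    · have h0 : ψ w = 0 := self_eq_neg.mp (hzw.symm.trans (hodd w))
      have h2 : w ^ 2 + c = c := hf.injOn hw hc (by rw [← hsq, h0, hf.map_base]; simp)
      have h3 : w = 0 := by simpa using h2
      simp [h3]
  · rintro _ ⟨z, hz, rfl⟩
    rw [mem_ball_zero_iff]
    refine (pow_lt_one_iff_of_nonneg (norm_nonneg _) two_ne_zero).mp ?_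
    rw [← norm_pow, hsq]
    exact hf.norm_lt_one _ hz
  · have ht2 : t ^ 2 ∈ ball (0 : ℂ) 1 := by
      rw [mem_ball_zero_iff] at ht ⊢
      rw [norm_pow]
      exact pow_lt_one₀ (norm_nonneg _) ht two_ne_zero
    obtain ⟨w, hw, hwt⟩ := hsurj ht2
    obtain ⟨z, hz⟩ := IsAlgClosed.exists_pow_nat_eq (w - c) two_pos
    have hzw : z ^ 2 + c = w := by rw [hz, sub_add_cancel]
    rcases sq_eq_sq_iff_eq_or_eq_neg.mp ((hsq z).trans ((congrArg f hzw).trans hwt)) with h | h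
    · exact ⟨z, by simpa [hzw] using hw, h⟩
    · exact ⟨-z, by simpa [hzw] using hw, by rw [hodd, h, neg_neg]⟩

lemma isSimplyConnected_setOf_sq_add_mem {B : Set ℂ} (hB : IsOpen B) (hsc : IsSimplyConnected B)
    {c : ℂ} (hc : c ∈ B) : IsSimplyConnected {z : ℂ | z ^ 2 + c ∈ B} := by
  have hconvex : ∀ s : Set ℂ, Convex ℝ s → s.Nonempty → IsSimplyConnected s := fun s hs hne ↦
    have := hs.contractibleSpace hne
    inferInstanceAs (SimplyConnectedSpace s)
  by_cases hne : B = univ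
  · simpa [hne] using hconvex univ convex_univ univ_nonempty
  · obtain ⟨ψ, hψ, hinj, himg⟩ := exists_injOn_image_eq_ball hB hsc hne hc
    have hU : IsOpen {z : ℂ | z ^ 2 + c ∈ B} := hB.preimage (by fun_prop)
    have hemb := isOpenEmbedding_restrict_of_injOn hU hψ hinj
    have hball := hconvex (ball (0 : ℂ) 1) (convex_ball 0 1) (nonempty_ball.mpr one_pos)
    have hrange : range (fun z : {z : ℂ | z ^ 2 + c ∈ B} ↦ ψ z) = ball 0 1 := by
      rw [← himg, image_eq_range]
    rw [← hrange] at hball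
    exact hemb.isEmbedding.toHomeomorph.toHomotopyEquiv.simplyConnectedSpace_iff.mpr hball

lemma isCompact_setOf_sq_add_mem {K : Set ℂ} (hK : IsCompact K) (c : ℂ) :
    IsCompact {z : ℂ | z ^ 2 + c ∈ K} := by
  refine Metric.isCompact_of_isClosed_isBounded (hK.isClosed.preimage (by fun_prop)) ?_
  obtain ⟨R, hR⟩ := hK.isBounded.exists_norm_le
  refine (Metric.isBounded_iff_subset_closedBall 0).mpr ⟨R + ‖c‖ + 1, fun z hz ↦ ?_⟩
  have h1 := hR _ hz
  have h2 := norm_sub_norm_le (z ^ 2) (-c)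
  rw [norm_neg, sub_neg_eq_add, norm_pow] at h2
  rw [mem_closedBall_zero_iff]
  nlinarith [sq_nonneg (‖z‖ - 1), norm_nonneg z]

/-- If `B` is an open, connected, simply connected subset of `ℂ` containing the critical
value `c` of `P_c(z) = z² + c`, then `U = P_c⁻¹(B)` is open, connected, simply connected,
contains the critical point `0`, and `P_c : U → B` is proper. -/
theorem preimage_of_simply_connected_domain_under_quadratic
    (c : ℂ) (B : Set ℂ) (hBopen : IsOpen B) (hBconn : IsConnected B)
    (hBsc : SimplyConnectedSpace B) (hcB : c ∈ B) :
    IsOpen {z : ℂ | z ^ 2 + c ∈ B} ∧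
    IsConnected {z : ℂ | z ^ 2 + c ∈ B} ∧
    SimplyConnectedSpace {z : ℂ | z ^ 2 + c ∈ B} ∧
    (0 : ℂ) ∈ {z : ℂ | z ^ 2 + c ∈ B} ∧
    ∀ K : Set ℂ, K ⊆ B → IsCompact K →
      IsCompact {z : ℂ | z ^ 2 + c ∈ B ∧ z ^ 2 + c ∈ K} := by
  have hU := isSimplyConnected_setOf_sq_add_mem hBopen hBsc hcB
  refine ⟨hBopen.preimage (by fun_prop), hU.isPathConnected.isConnected, hU, by simpa using hcB,
    fun K hKB hK ↦ ?_⟩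
  convert isCompact_setOf_sq_add_mem hK c using 3 with z
  exact and_iff_right_of_imp fun h ↦ hKB h
end
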